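/- (Higher derived brackets, Voronov) Let L be a Z-graded Lie superalgebra, P a projector onto an abelian subalgebra V with P[ℓ,ℓ'] = P[Pℓ,ℓ'] + P[ℓ,Pℓ'], and let D be an odd derivation of L preserving K = Ker P with D²(V) = 0. Then the higher derived brackets {v_1,...,v_k}_D := P[...[[Dv_1,v_2],v_3],...,v_k] define an L∞-antialgebra structure on V, i.e., graded symmetric degree-1 multilinear maps satisfying the generalized Jacobi identities Σ_{i+j=r+1} Σ_{σ∈Sh(i,j-1)} ε(σ) {{v_{σ(1)},...,v_{σ(i)}}_D, v_{σ(i+1)},...,v_{σ(r)}}_D = 0. -/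

import Mathlib

open Finset

/-- `(-1)^k` for an integer `k`. -/
def n1p (k : ℤ) : ℤ := if Even k then 1 else -1

/-- Koszul sign of the permutation `σ` relative to the degrees `d`. -/
def koszulSign {r : ℕ} (d : Fin r → ℤ) (σ : Equiv.Perm (Fin r)) : ℤ :=
  ∏ p ∈ Finset.univ.filter
      (fun p : Fin r × Fin r => p.1 < p.2 ∧ σ p.2 < σ p.1),
    n1p (d (σ p.1) * d (σ p.2))

/-- `(i, r-i)`-shuffles inside `Perm (Fin r)`. -/
def shuffles (i r : ℕ) : Finset (Equiv.Perm (Fin r)) :=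
  Finset.univ.filter (fun σ =>
    (∀ a b : Fin r, a < b → (b : ℕ) < i → σ a < σ b) ∧
    (∀ a b : Fin r, a < b → i ≤ (a : ℕ) → σ a < σ b))

/-- The nested term `ℓ_{r+1-i}(ℓ_i(x_{σ(1)},…,x_{σ(i)}), x_{σ(i+1)},…,x_{σ(r)})`. -/
def nestedTerm {V : Type*} {r : ℕ} (hr : 0 < r)
    (ℓ : ∀ k : ℕ, (Fin k → V) → V) (i : ℕ)
    (σ : Equiv.Perm (Fin r)) (x : Fin r → V) : V :=
  ℓ (r + 1 - i) (fun b =>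
    if (b : ℕ) = 0 then
      ℓ i (fun a => x (σ ⟨(a : ℕ) % r, Nat.mod_lt _ hr⟩))
    else x (σ ⟨(i + (b : ℕ) - 1) % r, Nat.mod_lt _ hr⟩))

/-- The higher derived bracket
`{v₁,…,v_k}_D = P[…[[Dv₁,v₂],v₃],…,v_k]`. -/
def derivedBracket {K L : Type*} [Field K] [AddCommGroup L] [Module K L]
    (B : L →ₗ[K] L →ₗ[K] L) (D P : L →ₗ[K] L) {k : ℕ} (x : Fin k → L) : L :=
  P (((List.ofFn x).drop 1).foldl (fun acc v => B acc v)
      (if h : 0 < k then D (x ⟨0, h⟩) else 0))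


theorem n1p_add (a b : ℤ) : n1p (a + b) = n1p a * n1p b := by
  unfold n1p; by_cases ha : Even a <;> by_cases hb : Even b <;> simp [ha, hb, Int.even_add]

theorem n1p_congr {a b : ℤ} (h : Even a ↔ Even b) : n1p a = n1p b := by
  unfold n1p; simp [h]

theorem n1p_neg_congr {a b : ℤ} (h : Even a ↔ ¬ Even b) : -n1p a = n1p b := by
  unfold n1p; by_cases hb : Even b <;> simp [h, hb]

theorem n1p_key (m a c : ℤ) :
    -(n1p (m * c + (1 + c) * (m + a) + a * c)) = n1p (1 + m + a) := by
  apply n1p_neg_congr; simp only [parity_simps]; tauto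

theorem n1p_self (a : ℤ) : n1p a * n1p a = 1 := by
  unfold n1p; split_ifs <;> simp

theorem n1p_zero : n1p 0 = 1 := by simp [n1p]

theorem n1p_sum {ι : Type*} (S : Finset ι) (f : ι → ℤ) : n1p (∑ a ∈ S, f a) = ∏ a ∈ S, n1p (f a) := by
  classical
  induction S using Finset.induction_on with
  | empty => simp [n1p_zero]
  | insert a S ha ih => rw [Finset.sum_insert ha, Finset.prod_insert ha, n1p_add, ih]

/-- The bundled hypotheses. -/
structure VD {K L : Type*} [Field K] [AddCommGroup L] [Module K L]
    (𝒢 : ℤ → Submodule K L) (B : L →ₗ[K] L →ₗ[K] L) (P D : L →ₗ[K] L) : Prop where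
  hBdeg : ∀ (i j : ℤ) (x y : L), x ∈ 𝒢 i → y ∈ 𝒢 j → B x y ∈ 𝒢 (i + j)
  hBanti : ∀ (i j : ℤ) (x y : L), x ∈ 𝒢 i → y ∈ 𝒢 j →
      B x y = - (n1p (i * j) • B y x)
  hBjac : ∀ (i j : ℤ) (x y z : L), x ∈ 𝒢 i → y ∈ 𝒢 j →
      B x (B y z) = B (B x y) z + n1p (i * j) • B y (B x z)
  hP2 : ∀ x, P (P x) = P x
  hPdeg : ∀ (i : ℤ), ∀ x ∈ 𝒢 i, P x ∈ 𝒢 i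
  habel : ∀ x y : L, B (P x) (P y) = 0
  hdist : ∀ x y : L, P (B x y) = P (B (P x) y) + P (B x (P y))
  hDdeg : ∀ (i : ℤ), ∀ x ∈ 𝒢 i, D x ∈ 𝒢 (i + 1)
  hDder : ∀ (i : ℤ) (x y : L), x ∈ 𝒢 i →
      D (B x y) = B (D x) y + n1p i • B x (D y)
  hDK : ∀ x : L, P x = 0 → P (D x) = 0
  hD2 : ∀ x : L, D (D (P x)) = 0

/-- The nested bracket of a list, before projecting. -/
def wl {K L : Type*} [Field K] [AddCommGroup L] [Module K L]
    (B : L →ₗ[K] L →ₗ[K] L) (D : L →ₗ[K] L) : List L → L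
  | [] => 0
  | a :: l => l.foldl (fun acc v => B acc v) (D a)

/-- Sign of an unshuffle. -/
def eps {ι : Type*} [LinearOrder ι] (d : ι → ℤ) (A C : Finset ι) : ℤ :=
  ∏ a ∈ A, ∏ c ∈ C, if c < a then n1p (d a * d c) else 1

theorem eps_insert_right_max {ι : Type*} [LinearOrder ι] (d : ι → ℤ) (A C : Finset ι) (n : ι)
    (hA : ∀ a ∈ A, a < n) (hC : n ∉ C) : eps d A (insert n C) = eps d A C := by
  unfold eps
  refine Finset.prod_congr rfl fun a ha => ?_
  rw [Finset.prod_insert hC, if_neg (not_lt.2 (hA a ha).le), one_mul]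

theorem eps_insert_left_max {ι : Type*} [LinearOrder ι] (d : ι → ℤ) (A C : Finset ι) (n : ι)
    (hA : n ∉ A) (hC : ∀ c ∈ C, c < n) :
    eps d (insert n A) C = n1p (d n * ∑ c ∈ C, d c) * eps d A C := by
  unfold eps
  rw [Finset.prod_insert hA, Finset.mul_sum, n1p_sum]
  congr 1
  exact Finset.prod_congr rfl fun c hc => by rw [if_pos (hC c hc)]

theorem eps_insert_left_min {ι : Type*} [LinearOrder ι] (d : ι → ℤ) (A C : Finset ι) (n : ι)
    (hA : n ∉ A) (hC : ∀ c ∈ C, n < c) :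
    eps d (insert n A) C = eps d A C := by
  unfold eps
  rw [Finset.prod_insert hA, Finset.prod_eq_one, one_mul]
  exact fun c hc => by rw [if_neg (not_lt.2 (hC c hc).le)]

theorem eps_insert_right_min {ι : Type*} [LinearOrder ι] (d : ι → ℤ) (A C : Finset ι) (n : ι)
    (hA : ∀ a ∈ A, n < a) (hC : n ∉ C) :
    eps d A (insert n C) = n1p (d n * ∑ a ∈ A, d a) * eps d A C := by
  unfold eps
  rw [Finset.mul_sum, n1p_sum, ← Finset.prod_mul_distrib]
  refine Finset.prod_congr rfl fun a ha => ?_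
  rw [Finset.prod_insert hC, if_pos (hA a ha), mul_comm (d a)]

theorem eps_swap {ι : Type*} [LinearOrder ι] (d : ι → ℤ) (A C : Finset ι) (h : Disjoint A C) :
    eps d C A = n1p ((∑ a ∈ A, d a) * ∑ c ∈ C, d c) * eps d A C := by
  have : eps d A C * eps d C A = n1p ((∑ a ∈ A, d a) * ∑ c ∈ C, d c) := by
    unfold eps
    rw [Finset.prod_comm (s := C), ← Finset.prod_mul_distrib, Finset.sum_mul, n1p_sum]
    refine Finset.prod_congr rfl fun a ha => ?_
    rw [← Finset.prod_mul_distrib, Finset.mul_sum, n1p_sum]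
    refine Finset.prod_congr rfl fun c hc => ?_
    have hne : a ≠ c := fun e => Finset.disjoint_left.1 h ha (e ▸ hc)
    rcases lt_or_gt_of_ne hne with h1 | h1
    · simp [h1, h1.le, mul_comm]
    · simp [h1, h1.le]
  have h2 : eps d A C * eps d A C = 1 := by
    unfold eps
    rw [← Finset.prod_mul_distrib]
    refine Finset.prod_eq_one fun a _ => ?_
    rw [← Finset.prod_mul_distrib]
    refine Finset.prod_eq_one fun c _ => ?_
    split_ifs <;> simp [n1p_self]
  rw [← this]; linear_combination (-eps d C A) * h2

section
variable {K L : Type*} [Field K] [AddCommGroup L] [Module K L]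
    {𝒢 : ℤ → Submodule K L} {B : L →ₗ[K] L →ₗ[K] L} {P D : L →ₗ[K] L}

theorem derivedBracket_eq {k : ℕ} (x : Fin k → L) :
    derivedBracket B D P x = P (wl B D (List.ofFn x)) := by
  unfold derivedBracket
  cases k with
  | zero => simp [wl]
  | succ k => rw [List.ofFn_succ]; simp [wl]

theorem wl_snoc (l : List L) (a : L) :
    wl B D (l ++ [a]) = if l = [] then D a else B (wl B D l) a := by
  cases l with
  | nil => simp [wl]
  | cons b l => simp [wl]

theorem VD.wl_deg (h : VD 𝒢 B P D) {ι : Type*} {x : ι → L} {d : ι → ℤ}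
    (hx : ∀ a, x a ∈ 𝒢 (d a) ∧ P (x a) = x a) (l : List ι) :
    wl B D (l.map x) ∈ 𝒢 (1 + (l.map d).sum) := by
  induction l using List.reverseRecOn with
  | nil => simp [wl]
  | append_singleton l a ih =>
    rw [List.map_append (f := x), List.map_singleton, wl_snoc]
    split_ifs with h0
    · have : l = [] := by simpa using h0
      subst this
      have := h.hDdeg _ _ (hx a).1
      simpa [add_comm] using this
    · have := h.hBdeg _ _ _ _ ih (hx a).1
      simpa [add_assoc] using this

theorem VD.ab (h : VD 𝒢 B P D) {u v : L} (hu : P u = u) (hv : P v = v) : B u v = 0 := by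
  rw [← hu, ← hv]; exact h.habel _ _

theorem VD.comm (h : VD 𝒢 B P D) {k i j : ℤ} {u v w : L} (hu : u ∈ 𝒢 k) (hv : v ∈ 𝒢 i) (hw : w ∈ 𝒢 j)
    (pv : P v = v) (pw : P w = w) : B (B u v) w = n1p (i * j) • B (B u w) v := by
  have h1 := h.hBjac k i u v w hu hv
  rw [h.ab pv pw, map_zero, h.hBanti _ _ v (B u w) hv (h.hBdeg _ _ _ _ hu hw)] at h1
  rw [smul_neg, smul_smul, ← n1p_add] at h1
  rw [eq_comm, ← sub_eq_add_neg, sub_eq_zero] at h1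
  rw [h1]; congr 1; apply n1p_congr; simp only [parity_simps]; tauto

theorem VD.commD (h : VD 𝒢 B P D) {i j : ℤ} {v w : L} (hv : v ∈ 𝒢 i) (hw : w ∈ 𝒢 j)
    (pv : P v = v) (pw : P w = w) : B (D v) w = n1p (i * j) • B (D w) v := by
  have h1 := h.hDder i v w hv
  rw [h.ab pv pw, map_zero, h.hBanti _ _ v (D w) hv (h.hDdeg _ _ hw)] at h1
  rw [smul_neg, smul_smul, ← n1p_add] at h1
  rw [eq_comm, ← sub_eq_add_neg, sub_eq_zero] at h1
  rw [h1]; congr 1; apply n1p_congr; simp only [parity_simps]; tauto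

theorem VD.wl_cons (h : VD 𝒢 B P D) {ι : Type*} {x : ι → L} {d : ι → ℤ}
    (hx : ∀ a, x a ∈ 𝒢 (d a) ∧ P (x a) = x a) {b : L} {e : ℤ} (hb : b ∈ 𝒢 e) (pb : P b = b)
    (l : List ι) (hl : l ≠ []) :
    wl B D (b :: l.map x) = n1p (e * (l.map d).sum) • B (wl B D (l.map x)) b := by
  induction l using List.reverseRecOn with
  | nil => exact absurd rfl hl
  | append_singleton l a ih =>
    rw [List.map_append, List.map_singleton, wl_snoc, ← List.cons_append, wl_snoc, if_neg (by simp)]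
    by_cases h0 : l = []
    · subst h0
      simpa [wl] using h.commD hb (hx a).1 pb (hx a).2
    · rw [ih h0, if_neg (by simpa using h0), map_zsmul, LinearMap.smul_apply,
        h.comm (h.wl_deg hx l) hb (hx a).1 pb (hx a).2, smul_smul, ← n1p_add]
      congr 2
      simp [mul_add]

theorem VD.wl_swap (h : VD 𝒢 B P D) {ι : Type*} {x : ι → L} {d : ι → ℤ}
    (hx : ∀ a, x a ∈ 𝒢 (d a) ∧ P (x a) = x a) (l : List ι) (a b : ι) (m : List ι) :
    wl B D ((l ++ a :: b :: m).map x) = n1p (d a * d b) • wl B D ((l ++ b :: a :: m).map x) := by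
  induction m using List.reverseRecOn with
  | nil =>
    have e1 : ∀ a b, (l ++ [a, b]).map x = (l.map x ++ [x a]) ++ [x b] := by simp
    rw [e1, e1, wl_snoc (_ ++ [x a]), wl_snoc (_ ++ [x b]), if_neg (by simp), if_neg (by simp), wl_snoc, wl_snoc]
    split_ifs
    · exact h.commD (hx a).1 (hx b).1 (hx a).2 (hx b).2
    · exact h.comm (h.wl_deg hx l) (hx a).1 (hx b).1 (hx a).2 (hx b).2
  | append_singleton m c ih =>
    have e1 : ∀ a b, (l ++ a :: b :: (m ++ [c])).map x = (l ++ a :: b :: m).map x ++ [x c] := by simp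
    rw [e1, e1, wl_snoc, wl_snoc, if_neg (by simp), if_neg (by simp), ih]
    simp

/-- nested bracket indexed by finset -/
def wf {ι : Type*} [LinearOrder ι] (B : L →ₗ[K] L →ₗ[K] L) (D : L →ₗ[K] L) (x : ι → L) (A : Finset ι) : L :=
  wl B D ((A.sort (· ≤ ·)).map x)

theorem sort_insert_max {ι : Type*} [LinearOrder ι] (A : Finset ι) (n : ι) (hA : ∀ a ∈ A, a < n) :
    (insert n A).sort (· ≤ ·) = A.sort (· ≤ ·) ++ [n] := by
  have hn : n ∉ A := fun hh => lt_irrefl _ (hA n hh)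
  apply List.Perm.eq_of_pairwise (le := (· ≤ ·))
  · intro a b _ _ h1 h2; exact le_antisymm h1 h2
  · exact Finset.pairwise_sort _ _
  · rw [List.pairwise_append]
    refine ⟨Finset.pairwise_sort _ _, by simp, ?_⟩
    intro a ha b hb
    simp at ha hb
    subst hb
    exact (hA a ha).le
  · rw [List.perm_ext_iff_of_nodup (Finset.sort_nodup _ _)]
    · intro a; simp; tauto
    · rw [List.nodup_append]
      refine ⟨Finset.sort_nodup _ _, by simp, ?_⟩
      intro a ha b hb
      simp at ha hb
      subst hb
      exact (hA a ha).ne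

theorem sort_sum {ι : Type*} [LinearOrder ι] (d : ι → ℤ) (A : Finset ι) :
    ((A.sort (· ≤ ·)).map d).sum = ∑ a ∈ A, d a := by
  rw [← List.sum_toFinset d (Finset.sort_nodup A (· ≤ ·)), Finset.sort_toFinset]

theorem sort_nil {ι : Type*} [LinearOrder ι] (A : Finset ι) :
    A.sort (· ≤ ·) = [] ↔ A = ∅ := by
  rw [← List.length_eq_zero_iff, Finset.length_sort, Finset.card_eq_zero]

theorem wf_insert {ι : Type*} [LinearOrder ι] (x : ι → L) (A : Finset ι) (n : ι) (hA : ∀ a ∈ A, a < n) :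
    wf B D x (insert n A) = B (wf B D x A) (x n) + if A = ∅ then D (x n) else 0 := by
  unfold wf
  rw [sort_insert_max _ _ hA, List.map_append, List.map_singleton, wl_snoc]
  simp only [List.map_eq_nil_iff, sort_nil]
  split_ifs with h0
  · subst h0; simp [wl]
  · simp

theorem wf_empty {ι : Type*} [LinearOrder ι] (x : ι → L) : wf B D x (∅ : Finset ι) = 0 := by
  simp [wf, wl]

theorem VD.wf_deg (h : VD 𝒢 B P D) {ι : Type*} [LinearOrder ι] {x : ι → L} {d : ι → ℤ}
    (hx : ∀ a, x a ∈ 𝒢 (d a) ∧ P (x a) = x a) (A : Finset ι) :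
    wf B D x A ∈ 𝒢 (1 + ∑ a ∈ A, d a) := by
  rw [← sort_sum]; exact h.wl_deg hx _

theorem VD.der3 (h : VD 𝒢 B P D) {i j k : ℤ} {u v w : L} (hu : u ∈ 𝒢 i) (hv : v ∈ 𝒢 j) (hw : w ∈ 𝒢 k) :
    B (B u v) w = B u (B v w) + n1p (j * k) • B (B u w) v := by
  rw [h.hBjac i j u v w hu hv, h.hBanti j (i + k) v (B u w) hv (h.hBdeg _ _ _ _ hu hw), smul_neg,
    smul_smul, ← n1p_add]
  rw [n1p_congr (a := i * j + j * (i + k)) (b := j * k)]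
  · abel
  · simp only [parity_simps]; tauto

theorem VD.D_wf (h : VD 𝒢 B P D) {ι : Type*} [LinearOrder ι] {x : ι → L} {d : ι → ℤ}
    (hx : ∀ a, x a ∈ 𝒢 (d a) ∧ P (x a) = x a) (m : ι) (T : Finset ι) (hT : ∀ t ∈ T, m < t) :
    D (wf B D x (insert m T)) = ∑ A ∈ T.powerset, (n1p (1 + d m + ∑ a ∈ A, d a) * eps d A (T \ A)) •
      B (wf B D x (insert m A)) (wf B D x (T \ A)) := by
  induction T using Finset.induction_on_max with
  | empty =>
    simp only [Finset.powerset_empty, Finset.sum_singleton, Finset.sdiff_self, wf_empty, map_zero, smul_zero]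
    rw [wf_insert _ _ _ (by simp), wf_empty]
    rw [← (hx m).2]
    simp [h.hD2]
  | insert n T hn ih =>
    have hnT : n ∉ T := fun hh => lt_irrefl _ (hn n hh)
    have hmn : m < n := hT n (by simp)
    have hmT : ∀ t ∈ T, m < t := fun t ht => hT t (by simp [ht])
    have hmT' : m ∉ T := fun hh => lt_irrefl _ (hmT m hh)
    specialize ih hmT
    have hmx : ∀ A ⊆ T, ∀ a ∈ insert m A, a < n := by
      intro A hA a ha
      rcases Finset.mem_insert.1 ha with rfl | ha
      · exact hmn
      · exact hn a (hA ha)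
    rw [Finset.insert_comm, wf_insert _ _ _ (hmx T subset_rfl), if_neg (by simp), add_zero,
      h.hDder _ _ _ (h.wf_deg hx _), ih, Finset.sum_powerset_insert hnT]
    have key : ∀ A ∈ T.powerset, B ((n1p (1 + d m + ∑ a ∈ A, d a) * eps d A (T \ A)) •
      B (wf B D x (insert m A)) (wf B D x (T \ A))) (x n) +
      (if A = T then (n1p (1 + d m + ∑ a ∈ T, d a)) • B (wf B D x (insert m T)) (D (x n)) else 0) =
      (n1p (1 + d m + ∑ a ∈ A, d a) * eps d A (insert n T \ A)) •
      B (wf B D x (insert m A)) (wf B D x (insert n T \ A)) +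
      (n1p (1 + d m + ∑ a ∈ insert n A, d a) * eps d (insert n A) (insert n T \ insert n A)) •
      B (wf B D x (insert m (insert n A))) (wf B D x (insert n T \ insert n A)) := by
      intro A hA
      have hA := Finset.mem_powerset.1 hA
      have hnA : n ∉ A := fun hh => hnT (hA hh)
      have e1 : insert n T \ A = insert n (T \ A) := by
        ext a; simp; grind
      have e2 : insert n T \ insert n A = T \ A := by
        ext a; simp; grind
      have hC : ∀ c ∈ T \ A, c < n := fun c hc => hn c (Finset.mem_sdiff.1 hc).1
      have hC' : n ∉ T \ A := fun hh => lt_irrefl _ (hC n hh)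
      rw [e1, e2, Finset.insert_comm m n A, wf_insert _ _ _ (hmx A hA), if_neg (Finset.insert_ne_empty _ _), add_zero,
        wf_insert _ _ _ hC, eps_insert_right_max _ _ _ _ (fun a ha => hn a (hA ha)) hC',
        eps_insert_left_max _ _ _ _ hnA hC, Finset.sum_insert hnA, map_add, map_zsmul, LinearMap.smul_apply,
        h.der3 (h.wf_deg hx _) (h.wf_deg hx _) (hx n).1, smul_add, smul_add, smul_smul]
      have e3 : T \ A = ∅ ↔ A = T := by
        rw [Finset.sdiff_eq_empty_iff_subset]
        exact ⟨fun hh => subset_antisymm hA hh, fun hh => hh ▸ subset_rfl⟩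
      have e4 : n1p (1 + d m + ∑ a ∈ A, d a) * eps d A (T \ A) * n1p ((1 + ∑ c ∈ T \ A, d c) * d n) =
        n1p (1 + d m + (d n + ∑ a ∈ A, d a)) * (n1p (d n * ∑ c ∈ T \ A, d c) * eps d A (T \ A)) := by
        simp only [n1p_add, add_mul, one_mul, mul_comm (d n)]
        ring
      have e5 : (n1p (1 + d m + ∑ a ∈ A, d a) * eps d A (T \ A)) • B (wf B D x (insert m A)) (if T \ A = ∅ then D (x n) else 0)
        = if A = T then (n1p (1 + d m + ∑ a ∈ T, d a)) • B (wf B D x (insert m T)) (D (x n)) else 0 := by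
        simp only [e3]
        split_ifs with h1
        · subst h1; simp [eps]
        · simp
      rw [e4, e5]
      abel
    rw [← Finset.sum_add_distrib, ← Finset.sum_congr rfl key, Finset.sum_add_distrib, Finset.sum_ite_eq' , if_pos (by simp),
      Finset.sum_insert hmT', map_sum, LinearMap.sum_apply, add_assoc]

set_option maxHeartbeats 1000000 in
/-- The Jacobi identity, indexed by subsets. -/
theorem VD.jacobi (h : VD 𝒢 B P D) {ι : Type*} [LinearOrder ι] {x : ι → L} {d : ι → ℤ}
    (hx : ∀ a, x a ∈ 𝒢 (d a) ∧ P (x a) = x a) (S : Finset ι) (hS : S.Nonempty) :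
    ∑ A ∈ S.powerset, eps d A (S \ A) •
      P (wl B D (P (wf B D x A) :: ((S \ A).sort (· ≤ ·)).map x)) = 0 := by
  obtain ⟨m, T, hmT, hST⟩ : ∃ m T, (∀ t ∈ T, m < t) ∧ S = insert m T := by
    refine ⟨S.min' hS, S.erase (S.min' hS), ?_, ?_⟩
    · intro t ht
      exact Finset.min'_lt_of_mem_erase_min' _ _ ht
    · rw [Finset.insert_erase (Finset.min'_mem _ _)]
  have hmT' : m ∉ T := fun hh => lt_irrefl _ (hmT m hh)
  have step : ∀ A ∈ S.powerset, eps d A (S \ A) •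
      P (wl B D (P (wf B D x A) :: ((S \ A).sort (· ≤ ·)).map x)) =
      (eps d A (S \ A) * n1p ((1 + ∑ a ∈ A, d a) * ∑ a ∈ S \ A, d a)) •
        P (B (wf B D x (S \ A)) (P (wf B D x A))) + if A = S then P (D (wf B D x S)) else 0 := by
    intro A hA
    have hA := Finset.mem_powerset.1 hA
    by_cases h1 : A = S
    · subst h1
      have : P (D (P (wf B D x A))) = P (D (wf B D x A)) := by
        have := h.hDK (P (wf B D x A) - wf B D x A) (by simp [h.hP2])
        rwa [map_sub, map_sub, sub_eq_zero] at this
      simp [wf_empty, eps, wl, this]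
    · have h2 : S \ A ≠ ∅ := by
        rw [Ne, Finset.sdiff_eq_empty_iff_subset]
        exact fun hh => h1 (subset_antisymm hA hh)
      rw [if_neg h1, add_zero, h.wl_cons hx (h.hPdeg _ _ (h.wf_deg hx A)) (h.hP2 _) _ (by rwa [Ne, sort_nil]),
        map_zsmul, smul_smul, sort_sum]
      rfl
  rw [Finset.sum_congr rfl step, Finset.sum_add_distrib, Finset.sum_ite_eq', if_pos (by simp)]
  subst hST
  rw [Finset.sum_powerset_insert hmT', h.D_wf hx m T hmT, map_sum]
  have split : ∀ A ∈ T.powerset, P ((n1p (1 + d m + ∑ a ∈ A, d a) * eps d A (T \ A)) •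
      B (wf B D x (insert m A)) (wf B D x (T \ A))) =
      -((eps d (insert m A) (insert m T \ insert m A) * n1p ((1 + ∑ a ∈ insert m A, d a) * ∑ a ∈ insert m T \ insert m A, d a)) •
        P (B (wf B D x (insert m T \ insert m A)) (P (wf B D x (insert m A))))) +
      (n1p (1 + d m + ∑ a ∈ A, d a) * eps d A (T \ A)) • P (B (wf B D x (insert m A)) (P (wf B D x (T \ A)))) := by
    intro A hA
    have hA := Finset.mem_powerset.1 hA
    have hmA : m ∉ A := fun hh => hmT' (hA hh)
    have e2 : insert m T \ insert m A = T \ A := by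
      ext a; simp; grind
    rw [e2, map_zsmul, h.hdist, smul_add, eps_insert_left_min _ _ _ _ hmA (fun c hc => hmT c (Finset.mem_sdiff.1 hc).1)]
    congr 1
    rw [h.hBanti _ _ _ _ (h.hPdeg _ _ (h.wf_deg hx _)) (h.wf_deg hx (T \ A)), map_neg, map_zsmul, smul_neg, smul_smul,
      Finset.sum_insert hmA]
    congr 2
    rw [mul_comm _ (eps d A (T \ A)), mul_assoc, ← n1p_add]
    congr 1
    apply n1p_congr; simp only [parity_simps]; tauto
  have other : ∑ A ∈ T.powerset, (n1p (1 + d m + ∑ a ∈ A, d a) * eps d A (T \ A)) • P (B (wf B D x (insert m A)) (P (wf B D x (T \ A))))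
    = - ∑ A ∈ T.powerset, (eps d A (insert m T \ A) * n1p ((1 + ∑ a ∈ A, d a) * ∑ a ∈ insert m T \ A, d a)) •
        P (B (wf B D x (insert m T \ A)) (P (wf B D x A))) := by
    rw [← Finset.sum_neg_distrib]
    refine Finset.sum_nbij' (fun A => T \ A) (fun A => T \ A) ?_ ?_ ?_ ?_ ?_
    · intro A _; simp
    · intro A _; simp
    · intro A hA; exact Finset.sdiff_sdiff_eq_self (Finset.mem_powerset.1 hA)
    · intro A hA; exact Finset.sdiff_sdiff_eq_self (Finset.mem_powerset.1 hA)
    · intro A hA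
      have hA := Finset.mem_powerset.1 hA
      have hmA : m ∉ A := fun hh => hmT' (hA hh)
      have e1 : insert m T \ (T \ A) = insert m A := by
        ext a; simp; grind
      rw [e1, eps_insert_right_min _ _ _ _ (fun c hc => hmT c (Finset.mem_sdiff.1 hc).1) hmA, Finset.sum_insert hmA,
        ← neg_smul, eps_swap d A (T \ A) Finset.disjoint_sdiff]
      congr 1
      have key : -(n1p (d m * ∑ a ∈ T \ A, d a + (1 + ∑ a ∈ T \ A, d a) * (d m + ∑ x ∈ A, d x) +
          (∑ a ∈ A, d a) * ∑ c ∈ T \ A, d c)) = n1p (1 + d m + ∑ a ∈ A, d a) := by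
        exact n1p_key _ _ _
      rw [n1p_add, n1p_add (d m * ∑ a ∈ T \ A, d a)] at key
      linear_combination (-eps d A (T \ A)) * key
  rw [Finset.sum_congr rfl split, Finset.sum_add_distrib, other, Finset.sum_neg_distrib]
  abel
end

theorem koszul_eq {r : ℕ} (d : Fin r → ℤ) (σ : Equiv.Perm (Fin r)) :
    koszulSign d σ = ∏ p ∈ Finset.univ.filter (fun p : Fin r × Fin r => p.1 < p.2),
      if σ p.2 < σ p.1 then n1p (d (σ p.1) * d (σ p.2)) else 1 := by
  unfold koszulSign
  rw [← Finset.prod_filter, Finset.filter_filter]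

theorem pair_reindex {r : ℕ} (h : Fin r → Fin r → ℤ) (hs : ∀ a b, h a b = h b a)
    (τ : Equiv.Perm (Fin r)) :
    ∏ p ∈ Finset.univ.filter (fun p : Fin r × Fin r => p.1 < p.2), h p.1 p.2 =
    ∏ p ∈ Finset.univ.filter (fun p : Fin r × Fin r => p.1 < p.2), h (τ p.1) (τ p.2) := by
  symm
  refine Finset.prod_nbij'
    (fun p => if τ p.1 < τ p.2 then (τ p.1, τ p.2) else (τ p.2, τ p.1))
    (fun p => if τ.symm p.1 < τ.symm p.2 then (τ.symm p.1, τ.symm p.2) else (τ.symm p.2, τ.symm p.1))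
    ?_ ?_ ?_ ?_ ?_
  · rintro ⟨a, b⟩ hp
    simp only [Finset.mem_filter, Finset.mem_univ, true_and] at hp ⊢
    have : τ a ≠ τ b := fun e => hp.ne (τ.injective e)
    split_ifs with h1
    · exact h1
    · exact lt_of_le_of_ne (not_lt.1 h1) this.symm
  · rintro ⟨a, b⟩ hp
    simp only [Finset.mem_filter, Finset.mem_univ, true_and] at hp ⊢
    have : τ.symm a ≠ τ.symm b := fun e => hp.ne (τ.symm.injective e)
    split_ifs with h1
    · exact h1
    · exact lt_of_le_of_ne (not_lt.1 h1) this.symm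
  · rintro ⟨a, b⟩ hp
    simp only [Finset.mem_filter, Finset.mem_univ, true_and] at hp
    by_cases h1 : τ a < τ b <;> simp [h1, hp, hp.le]
  · rintro ⟨a, b⟩ hp
    simp only [Finset.mem_filter, Finset.mem_univ, true_and] at hp
    by_cases h1 : τ.symm a < τ.symm b <;> simp [h1, hp, hp.le]
  · rintro ⟨a, b⟩ hp
    by_cases h1 : τ a < τ b <;> simp [h1, hs]

theorem koszul_mul {r : ℕ} (d : Fin r → ℤ) (σ τ : Equiv.Perm (Fin r)) :
    koszulSign d (σ * τ) = koszulSign d σ * koszulSign (d ∘ σ) τ := by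
  have h1 : koszulSign d σ = ∏ p ∈ Finset.univ.filter (fun p : Fin r × Fin r => p.1 < p.2),
      (fun a b => if (a < b ∧ σ b < σ a) ∨ (b < a ∧ σ a < σ b) then n1p (d (σ a) * d (σ b)) else 1) p.1 p.2 := by
    rw [koszul_eq]
    refine Finset.prod_congr rfl fun p hp => ?_
    have hp : p.1 < p.2 := by simpa using hp
    simp [hp, hp.le, not_lt_of_gt hp]
  rw [h1, pair_reindex (fun a b => if (a < b ∧ σ b < σ a) ∨ (b < a ∧ σ a < σ b) then n1p (d (σ a) * d (σ b)) else 1) ?_ τ, koszul_eq, koszul_eq, ← Finset.prod_mul_distrib]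
  · refine Finset.prod_congr rfl fun p hp => ?_
    have hp : p.1 < p.2 := by simpa using hp
    have hne : τ p.1 ≠ τ p.2 := fun e => hp.ne (τ.injective e)
    have hne' : σ (τ p.1) ≠ σ (τ p.2) := fun e => hne (σ.injective e)
    have := n1p_self (d (σ (τ p.1)) * d (σ (τ p.2)))
    simp only [Equiv.Perm.mul_apply, Function.comp]
    rcases lt_or_gt_of_ne hne with h2 | h2 <;> rcases lt_or_gt_of_ne hne' with h3 | h3 <;>
      simp [h2, h3, not_lt_of_gt h2, not_lt_of_gt h3, this]
  · intro a b
    simp only [mul_comm (d (σ a))]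
    congr 1
    exact propext (or_comm)

theorem koszul_one {r : ℕ} (d : Fin r → ℤ) : koszulSign d 1 = 1 := by
  rw [koszul_eq]
  refine Finset.prod_eq_one fun p hp => ?_
  have hp : p.1 < p.2 := by simpa using hp
  simp [not_lt_of_gt hp]

theorem koszul_adj {n : ℕ} (d : Fin (n + 1) → ℤ) (i : Fin n) :
    koszulSign d (Equiv.swap i.castSucc i.succ) = n1p (d i.succ * d i.castSucc) := by
  unfold koszulSign
  have : Finset.univ.filter (fun p : Fin (n + 1) × Fin (n + 1) => p.1 < p.2 ∧
      Equiv.swap i.castSucc i.succ p.2 < Equiv.swap i.castSucc i.succ p.1) = {(i.castSucc, i.succ)} := by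
    ext ⟨a, b⟩
    simp only [Finset.mem_filter, Finset.mem_univ, true_and, Finset.mem_singleton, Prod.mk.injEq,
      Equiv.swap_apply_def, Fin.ext_iff, Fin.lt_def]
    split_ifs <;> simp at * <;> omega
  rw [this]
  simp

theorem ofFn_adj {α : Type*} {n : ℕ} (x : Fin (n + 1) → α) (i : Fin n) :
    List.ofFn x = (List.ofFn x).take i ++ x i.castSucc :: x i.succ :: (List.ofFn x).drop (i + 2) := by
  conv_lhs =>
    rw [← List.take_append_drop i (List.ofFn x), List.drop_eq_getElem_cons (by simp),
      List.drop_eq_getElem_cons (by simp)]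
  simp only [List.getElem_ofFn]
  rfl

section
variable {K L : Type*} [Field K] [AddCommGroup L] [Module K L]
    {𝒢 : ℤ → Submodule K L} {B : L →ₗ[K] L →ₗ[K] L} {P D : L →ₗ[K] L}

theorem VD.symm (h : VD 𝒢 B P D) {n : ℕ} (σ : Equiv.Perm (Fin (n + 1))) :
    ∀ (d : Fin (n + 1) → ℤ) (x : Fin (n + 1) → L), (∀ a, x a ∈ 𝒢 (d a) ∧ P (x a) = x a) →
    wl B D (List.ofFn (x ∘ σ)) = koszulSign d σ • wl B D (List.ofFn x) := by
  have hσ : σ ∈ Submonoid.closure (Set.range fun i : Fin n ↦ Equiv.swap i.castSucc i.succ) := by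
    rw [Equiv.Perm.mclosure_swap_castSucc_succ]; trivial
  induction hσ using Submonoid.closure_induction with
  | mem σ hσ =>
    obtain ⟨i, rfl⟩ := hσ
    intro d x hx
    dsimp only
    rw [koszul_adj]
    have e1 : ∀ s : Equiv.Perm (Fin (n + 1)), List.ofFn (x ∘ s) = (List.ofFn s).map x := by
      intro s; rw [List.map_ofFn]
    have e2 := ofFn_adj (fun a : Fin (n+1) => a) i
    have e3 := ofFn_adj (Equiv.swap i.castSucc i.succ) i
    have e4 : (List.ofFn (Equiv.swap i.castSucc i.succ)).take i = (List.ofFn (fun a : Fin (n+1) => a)).take i := by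
      apply List.ext_getElem (by simp)
      intro k h1 h2
      simp at h1
      simp only [List.getElem_take, List.getElem_ofFn]
      apply Equiv.swap_apply_of_ne_of_ne <;> simp [Fin.ext_iff] <;> omega
    have e5 : (List.ofFn (Equiv.swap i.castSucc i.succ)).drop (i+2) = (List.ofFn (fun a : Fin (n+1) => a)).drop (i+2) := by
      apply List.ext_getElem (by simp)
      intro k h1 h2
      simp only [List.getElem_drop, List.getElem_ofFn]
      apply Equiv.swap_apply_of_ne_of_ne <;> simp [Fin.ext_iff] <;> omega
    have e6 : List.ofFn x = (List.ofFn (fun a : Fin (n+1) => a)).map x := by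
      rw [List.map_ofFn]; rfl
    rw [e1, e6, e2, e3, e4, e5, Equiv.swap_apply_left, Equiv.swap_apply_right]
    exact h.wl_swap hx _ _ _ _
  | one => intro d x _; simp [koszul_one]
  | mul σ τ _ _ h1 h2 =>
    intro d x hx
    have := h2 (d ∘ σ) (x ∘ σ) (fun a => hx (σ a))
    rw [koszul_mul, Equiv.Perm.coe_mul, ← Function.comp_assoc, this, h1 d x hx, smul_smul, mul_comm]
end

/-- The set of values in the first block of a shuffle. -/
def blk {r : ℕ} (i : ℕ) (σ : Equiv.Perm (Fin r)) : Finset (Fin r) :=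
  Finset.univ.filter (fun a => (σ.symm a : ℕ) < i)

theorem sort_blk {r i : ℕ} (hi : i ≤ r) (σ : Equiv.Perm (Fin r)) (hσ : σ ∈ shuffles i r) :
    (blk i σ).sort (· ≤ ·) = List.ofFn (fun a : Fin i => σ ⟨a, by omega⟩) := by
  simp only [shuffles, Finset.mem_filter, Finset.mem_univ, true_and] at hσ
  have hl : (List.ofFn (fun a : Fin i => σ ⟨a, by omega⟩)).Nodup := by
    rw [List.nodup_ofFn]
    intro a b hab
    have := σ.injective hab
    simpa [Fin.ext_iff] using this
  have e : blk i σ = (List.ofFn (fun a : Fin i => σ ⟨a, by omega⟩)).toFinset := by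
    ext a
    simp only [blk, Finset.mem_filter, Finset.mem_univ, true_and, List.mem_toFinset, List.mem_ofFn]
    constructor
    · intro h; exact ⟨⟨σ.symm a, h⟩, by simp⟩
    · rintro ⟨b, rfl⟩; simp
  rw [e]
  refine (List.toFinset_sort (· ≤ ·) hl).2 ?_
  rw [List.pairwise_ofFn]
  intro a b hab
  exact (hσ.1 _ _ hab b.2).le

theorem sort_blk_compl {r i : ℕ} (hi : i ≤ r) (σ : Equiv.Perm (Fin r)) (hσ : σ ∈ shuffles i r) :
    (Finset.univ \ blk i σ).sort (· ≤ ·) = List.ofFn (fun a : Fin (r - i) => σ ⟨i + a, by omega⟩) := by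
  simp only [shuffles, Finset.mem_filter, Finset.mem_univ, true_and] at hσ
  have hl : (List.ofFn (fun a : Fin (r - i) => σ ⟨i + a, by omega⟩)).Nodup := by
    rw [List.nodup_ofFn]
    intro a b hab
    have := σ.injective hab
    simpa [Fin.ext_iff] using this
  have e : Finset.univ \ blk i σ = (List.ofFn (fun a : Fin (r - i) => σ ⟨i + a, by omega⟩)).toFinset := by
    ext a
    simp only [blk, Finset.mem_sdiff, Finset.mem_filter, Finset.mem_univ, true_and, List.mem_toFinset, List.mem_ofFn]
    constructor
    · intro h
      refine ⟨⟨σ.symm a - i, by omega⟩, ?_⟩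
      rw [← Equiv.eq_symm_apply]
      ext; simp; omega
    · rintro ⟨b, rfl⟩; simp
  rw [e]
  refine (List.toFinset_sort (· ≤ ·) hl).2 ?_
  rw [List.pairwise_ofFn]
  intro a b hab
  refine (hσ.2 _ _ ?_ ?_).le
  · have hab' : (a : ℕ) < b := hab
    exact Nat.add_lt_add_left hab' i
  · simp

theorem koszul_shuffle {r i : ℕ} (d : Fin r → ℤ) (σ : Equiv.Perm (Fin r)) (hσ : σ ∈ shuffles i r) :
    koszulSign d σ = eps d (blk i σ) (Finset.univ \ blk i σ) := by
  simp only [shuffles, Finset.mem_filter, Finset.mem_univ, true_and] at hσ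
  unfold koszulSign eps
  rw [← Finset.prod_product', ← Finset.prod_filter]
  refine Finset.prod_nbij' (fun p => (σ p.1, σ p.2)) (fun p => (σ.symm p.1, σ.symm p.2)) ?_ ?_ ?_ ?_ ?_
  · rintro ⟨a, b⟩ hp
    simp only [Finset.mem_filter, Finset.mem_univ, true_and, blk, Finset.mem_product, Finset.mem_sdiff,
      Equiv.symm_apply_apply] at hp ⊢
    refine ⟨⟨?_, ?_⟩, hp.2⟩
    · by_contra h1
      exact lt_asymm hp.2 (hσ.2 a b hp.1 (by omega))
    · intro h1
      exact lt_asymm hp.2 (hσ.1 a b hp.1 (by omega))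
  · rintro ⟨a, b⟩ hp
    simp only [Finset.mem_filter, Finset.mem_univ, true_and, blk, Finset.mem_product, Finset.mem_sdiff,
      Equiv.apply_symm_apply] at hp ⊢
    refine ⟨?_, hp.2⟩
    rw [Fin.lt_def]; omega
  · intro p _; simp
  · intro p _; simp
  · intro p _; simp

theorem blk_inj {r i j : ℕ} (hi : i ≤ r) (hj : j ≤ r) (σ τ : Equiv.Perm (Fin r)) (hσ : σ ∈ shuffles i r)
    (hτ : τ ∈ shuffles j r) (h : blk i σ = blk j τ) : i = j ∧ σ = τ := by
  have h1 := sort_blk hi σ hσ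
  have h2 := sort_blk hj τ hτ
  have h3 := sort_blk_compl hi σ hσ
  have h4 := sort_blk_compl hj τ hτ
  rw [h, h2] at h1
  rw [h, h4] at h3
  have hij : i = j := by simpa using (congrArg List.length h1).symm
  subst hij
  refine ⟨rfl, ?_⟩
  have h1 := List.ofFn_injective h1
  have h3 := List.ofFn_injective h3
  ext a
  by_cases ha : (a : ℕ) < i
  · exact congrArg Fin.val (congrFun h1 ⟨a, ha⟩).symm
  · have := congrFun h3 ⟨a - i, by omega⟩
    have e : (⟨i + (a - i), by omega⟩ : Fin r) = a := by ext; simp; omega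
    simp only [e] at this
    rw [this]

theorem blk_surj {r : ℕ} (A : Finset (Fin r)) :
    ∃ σ ∈ shuffles A.card r, blk A.card σ = A := by
  have hlen : (A.sort (· ≤ ·) ++ (Finset.univ \ A).sort (· ≤ ·)).length = r := by
    have := Finset.card_le_univ A
    have h2 := Finset.card_sdiff_add_card_eq_card (Finset.subset_univ A)
    simp at this h2
    rw [List.length_append, Finset.length_sort, Finset.length_sort]
    omega
  have hnd : (A.sort (· ≤ ·) ++ (Finset.univ \ A).sort (· ≤ ·)).Nodup := by
    rw [List.nodup_append]
    refine ⟨Finset.sort_nodup _ _, Finset.sort_nodup _ _, ?_⟩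
    intro a ha b hb
    simp at ha hb
    rintro rfl
    exact hb ha
  have hinj : Function.Injective (fun a : Fin r =>
      (A.sort (· ≤ ·) ++ (Finset.univ \ A).sort (· ≤ ·))[(a : ℕ)]'(by omega)) := by
    intro a b hab
    ext
    exact (List.Nodup.getElem_inj_iff hnd).1 hab
  have hA : (A.sort (· ≤ ·)).length = A.card := Finset.length_sort _
  let σ : Equiv.Perm (Fin r) := Equiv.ofBijective _ (Finite.injective_iff_bijective.1 hinj)
  have hσ : ∀ a : Fin r, σ a = (A.sort (· ≤ ·) ++ (Finset.univ \ A).sort (· ≤ ·))[(a : ℕ)]'(by omega) := fun a => rfl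
  have hmem : ∀ a : Fin r, σ a ∈ A ↔ (a : ℕ) < A.card := by
    intro a
    rw [hσ, List.getElem_append]
    split_ifs with h1
    · rw [← hA]
      simp only [h1, iff_true]
      exact (Finset.mem_sort (· ≤ ·)).1 (List.getElem_mem _)
    · rw [← hA]
      simp only [h1, iff_false]
      have := (Finset.mem_sort (s := Finset.univ \ A) (· ≤ ·)).1 (List.getElem_mem (l := (Finset.univ \ A).sort (· ≤ ·)) (n := a - (A.sort (· ≤ ·)).length) (by rw [List.length_append] at hlen; omega))
      exact (Finset.mem_sdiff.1 this).2
  have hs1 := (Finset.sortedLT_sort A).pairwise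
  have hs2 := (Finset.sortedLT_sort (Finset.univ \ A)).pairwise
  rw [List.pairwise_iff_getElem] at hs1 hs2
  refine ⟨σ, ?_, ?_⟩
  · simp only [shuffles, Finset.mem_filter, Finset.mem_univ, true_and]
    constructor
    · intro a b hab hb
      have hab' : (a : ℕ) < b := hab
      rw [hσ, hσ, List.getElem_append_left (by omega), List.getElem_append_left (by omega)]
      exact hs1 _ _ _ _ hab'
    · intro a b hab ha
      have hab' : (a : ℕ) < b := hab
      rw [hσ, hσ, List.getElem_append_right (by omega), List.getElem_append_right (by omega)]
      exact hs2 _ _ _ _ (by omega)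
  · ext a
    simp only [blk, Finset.mem_filter, Finset.mem_univ, true_and]
    rw [← hmem, Equiv.apply_symm_apply]

section
variable {K L : Type*} [Field K] [AddCommGroup L] [Module K L]
    {𝒢 : ℤ → Submodule K L} {B : L →ₗ[K] L →ₗ[K] L} {P D : L →ₗ[K] L}

theorem nested_eq {r i : ℕ} (hr : 0 < r) (hi : i ≤ r) (σ : Equiv.Perm (Fin r)) (hσ : σ ∈ shuffles i r)
    (x : Fin r → L) :
    nestedTerm hr (fun k (y : Fin k → L) => derivedBracket B D P y) i σ x =
    P (wl B D (P (wf B D x (blk i σ)) :: ((Finset.univ \ blk i σ).sort (· ≤ ·)).map x)) := by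
  unfold nestedTerm
  simp only [derivedBracket_eq]
  have e1 : List.ofFn (fun a : Fin i => x (σ ⟨(a : ℕ) % r, Nat.mod_lt _ hr⟩)) = ((blk i σ).sort (· ≤ ·)).map x := by
    rw [sort_blk hi σ hσ, List.map_ofFn]
    congr 1
    funext a
    have : (a : ℕ) % r = a := Nat.mod_eq_of_lt (by omega)
    simp [this]
  rw [e1]
  congr 2
  rw [sort_blk_compl hi σ hσ, List.map_ofFn]
  apply List.ext_getElem
  · simp; omega
  · intro k h1 h2
    simp at h1
    rw [List.getElem_ofFn]
    rcases k with _ | k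
    · simp [wf]
    · have : (i + (k + 1) - 1) % r = i + k := Nat.mod_eq_of_lt (by omega)
      simp only [List.getElem_cons_succ, List.getElem_ofFn, Function.comp, this]
      simp

theorem VD.jacobi' (h : VD 𝒢 B P D) {r : ℕ} (hr : 0 < r) (d : Fin r → ℤ) (x : Fin r → L)
    (hx : ∀ a, x a ∈ 𝒢 (d a) ∧ P (x a) = x a) :
    ∑ i ∈ Finset.Icc 1 r, ∑ σ ∈ shuffles i r,
        koszulSign d σ •
          nestedTerm hr (fun k (y : Fin k → L) => derivedBracket B D P y)
            i σ x = 0 := by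
  rw [← h.jacobi hx Finset.univ ⟨⟨0, hr⟩, by simp⟩]
  rw [← Finset.sum_filter_of_ne (p := fun A : Finset (Fin r) => A.Nonempty), Finset.sum_sigma']
  · refine Finset.sum_nbij (fun p => blk p.1 p.2) ?_ ?_ ?_ ?_
    · rintro ⟨i, σ⟩ hp
      simp only [Finset.mem_sigma, Finset.mem_Icc] at hp
      simp only [Finset.mem_filter, Finset.mem_powerset, Finset.subset_univ, true_and]
      refine ⟨σ ⟨0, hr⟩, ?_⟩
      simp [blk]; omega
    · rintro ⟨i, σ⟩ hp ⟨j, τ⟩ hq hpq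
      simp only [Finset.mem_coe, Finset.mem_sigma, Finset.mem_Icc] at hp hq
      obtain ⟨rfl, rfl⟩ := blk_inj hp.1.2 hq.1.2 σ τ hp.2 hq.2 hpq
      rfl
    · intro A hA
      have hA : A.Nonempty := by simpa using hA
      obtain ⟨σ, hσ, e⟩ := blk_surj A
      refine ⟨⟨A.card, σ⟩, ?_, e⟩
      simp only [Finset.mem_coe, Finset.mem_sigma, Finset.mem_Icc]
      refine ⟨⟨hA.card_pos, ?_⟩, hσ⟩
      simpa using Finset.card_le_univ A
    · rintro ⟨i, σ⟩ hp
      simp only [Finset.mem_sigma, Finset.mem_Icc] at hp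
      dsimp only
      rw [nested_eq hr hp.1.2 σ hp.2, koszul_shuffle d σ hp.2]
  · intro A _ hne
    by_contra h0
    rw [Finset.not_nonempty_iff_eq_empty] at h0
    subst h0
    apply hne
    have : ∀ l : List L, l.foldl (fun acc v => B acc v) 0 = 0 := by
      intro l
      induction l with
      | nil => rfl
      | cons a l ih => simpa using ih
    simp [wf_empty, wl, this]
end

/-- (Voronov's higher derived brackets.)  Let `L` be a ℤ-graded Lie
superalgebra (with graded bracket `B`), `P` a projector onto an abelian
subalgebra `V = P(L)` satisfying `P[ℓ,ℓ'] = P[Pℓ,ℓ'] + P[ℓ,Pℓ']`, and `D` an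
odd (degree-1) derivation of `L` preserving `K = Ker P` with `D²(V) = 0`.
Then the higher derived brackets `{v₁,…,v_k}_D = P[…[[Dv₁,v₂],…],v_k]` define
an `L∞`-antialgebra structure on `V`: they are graded symmetric multilinear
maps of degree `1` with values in `V`, satisfying the generalized Jacobi
identities
`Σ_{i+j=r+1} Σ_{σ∈Sh(i,j-1)} ε(σ) {{v_{σ(1)},…,v_{σ(i)}}_D, v_{σ(i+1)},…,v_{σ(r)}}_D = 0`. -/
theorem higher_derived_brackets
    {K L : Type*} [Field K] [AddCommGroup L] [Module K L]
    (𝒢 : ℤ → Submodule K L)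
    (B : L →ₗ[K] L →ₗ[K] L)
    (hBdeg : ∀ (i j : ℤ) (x y : L), x ∈ 𝒢 i → y ∈ 𝒢 j → B x y ∈ 𝒢 (i + j))
    (hBanti : ∀ (i j : ℤ) (x y : L), x ∈ 𝒢 i → y ∈ 𝒢 j →
      B x y = - (n1p (i * j) • B y x))
    (hBjac : ∀ (i j : ℤ) (x y z : L), x ∈ 𝒢 i → y ∈ 𝒢 j →
      B x (B y z) = B (B x y) z + n1p (i * j) • B y (B x z))
    (P : L →ₗ[K] L)
    (hP2 : ∀ x, P (P x) = P x)
    (hPdeg : ∀ (i : ℤ), ∀ x ∈ 𝒢 i, P x ∈ 𝒢 i)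
    (habel : ∀ x y : L, B (P x) (P y) = 0)
    (hdist : ∀ x y : L, P (B x y) = P (B (P x) y) + P (B x (P y)))
    (D : L →ₗ[K] L)
    (hDdeg : ∀ (i : ℤ), ∀ x ∈ 𝒢 i, D x ∈ 𝒢 (i + 1))
    (hDder : ∀ (i : ℤ) (x y : L), x ∈ 𝒢 i →
      D (B x y) = B (D x) y + n1p i • B x (D y))
    (hDK : ∀ x : L, P x = 0 → P (D x) = 0)
    (hD2 : ∀ x : L, D (D (P x)) = 0) :
    (∀ (k : ℕ), 1 ≤ k → ∀ (d : Fin k → ℤ) (x : Fin k → L),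
      (∀ a, x a ∈ 𝒢 (d a) ∧ P (x a) = x a) →
      derivedBracket B D P x ∈ 𝒢 (1 + ∑ a, d a) ∧
      P (derivedBracket B D P x) = derivedBracket B D P x) ∧
    (∀ (k : ℕ), 1 ≤ k → ∀ (d : Fin k → ℤ) (x : Fin k → L),
      (∀ a, x a ∈ 𝒢 (d a) ∧ P (x a) = x a) →
      ∀ σ : Equiv.Perm (Fin k),
        derivedBracket B D P (x ∘ σ) = koszulSign d σ • derivedBracket B D P x) ∧
    (∀ (r : ℕ) (hr : 0 < r) (d : Fin r → ℤ) (x : Fin r → L),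
      (∀ a, x a ∈ 𝒢 (d a) ∧ P (x a) = x a) →
      ∑ i ∈ Finset.Icc 1 r, ∑ σ ∈ shuffles i r,
        koszulSign d σ •
          nestedTerm hr (fun k (y : Fin k → L) => derivedBracket B D P y)
            i σ x = 0) := by
  have h : VD 𝒢 B P D := ⟨hBdeg, hBanti, hBjac, hP2, hPdeg, habel, hdist, hDdeg, hDder, hDK, hD2⟩
  refine ⟨?_, ?_, ?_⟩
  · intro k _ d x hx
    rw [derivedBracket_eq]
    refine ⟨hPdeg _ _ ?_, hP2 _⟩
    have := h.wl_deg hx (List.ofFn (fun a => a))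
    rw [List.map_ofFn, List.map_ofFn, List.sum_ofFn] at this
    exact this
  · intro k hk d x hx σ
    obtain ⟨n, rfl⟩ : ∃ n, k = n + 1 := ⟨k - 1, by omega⟩
    rw [derivedBracket_eq, derivedBracket_eq, h.symm σ d x hx, map_zsmul]
  · intro r hr d x hx
    exact h.jacobi' hr d x hx
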